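/- The center of an irreducible, infinite Coxeter group (W,S) of finite rank is trivial. -/

import Mathlib

namespace CoxeterPaper

/-- The entry `-cos (π / m i j)` of the matrix of the standard bilinear form,
interpreted as `-1` when `m i j = ∞` (encoded as `0`). -/
noncomputable def formEntry {B : Type*} (M : CoxeterMatrix B) (i j : B) : ℝ :=
  if M i j = 0 then -1 else - Real.cos (Real.pi / (M i j : ℝ))

/-- The standard bilinear form associated to a Coxeter matrix, on `V = B → ℝ`
(with basis `{α_s : s ∈ S}` identified with the standard basis). -/
noncomputable def bilin {B : Type*} [Fintype B] (M : CoxeterMatrix B) (v w : B → ℝ) : ℝ :=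
  ∑ i, ∑ j, v i * w j * formEntry M i j

/-- The standard bilinear form is positive definite. -/
def IsPosDef {B : Type*} [Fintype B] (M : CoxeterMatrix B) : Prop :=
  ∀ v : B → ℝ, v ≠ 0 → 0 < bilin M v v

/-- The standard bilinear form is positive semidefinite. -/
def IsPosSemidef {B : Type*} [Fintype B] (M : CoxeterMatrix B) : Prop :=
  ∀ v : B → ℝ, 0 ≤ bilin M v v

/-- The Coxeter graph: vertices are the elements of `B`, and `i ≠ j` are adjacent
iff `m i j ≥ 3` (including `m i j = ∞`, encoded as `0`), i.e. iff `m i j ≠ 2`. -/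
def coxeterGraph {B : Type*} (M : CoxeterMatrix B) : SimpleGraph B :=
  SimpleGraph.fromRel fun i j => M i j ≠ 2

/-- A Coxeter matrix (system) is irreducible if its Coxeter graph is connected. -/
def IsIrreducible {B : Type*} (M : CoxeterMatrix B) : Prop := (coxeterGraph M).Connected

section Reflections

open Module Polynomial.Chebyshev

variable {B : Type*} (M : CoxeterMatrix B)

theorem formEntry_self (i : B) : formEntry M i i = 1 := by
  simp [formEntry]

theorem formEntry_comm (i j : B) : formEntry M i j = formEntry M j i := by
  simp [formEntry, M.symmetric i j]

theorem formEntry_ne_zero {i j : B} (hij : i ≠ j) (h : M i j ≠ 2) : formEntry M i j ≠ 0 := by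
  unfold formEntry
  split_ifs with h0
  · norm_num
  · have h1 : M i j ≠ 1 := M.off_diagonal i j hij
    have h3 : (3 : ℝ) ≤ M i j := by exact_mod_cast (by omega : 3 ≤ M i j)
    have hpos := Real.pi_pos
    refine neg_ne_zero.mpr (Real.cos_pos_of_mem_Ioo ⟨?_, ?_⟩).ne'
    · have : 0 < Real.pi / (M i j : ℝ) := by positivity
      linarith
    · rw [div_lt_div_iff₀ (by linarith) two_pos]
      nlinarith

/-- If `f y = g x = -2 cos (π / m)` with `2 ≤ m`, then the product of the reflections attached to
`(x, f)` and `(y, g)` has order dividing `m`. -/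
theorem reflection_mul_reflection_pow_eq_one {V : Type*} [AddCommGroup V] [Module ℝ V]
    {x y : V} {f g : Dual ℝ V} (hf : f x = 2) (hg : g y = 2) {m : ℕ} (hm : 2 ≤ m)
    (hfy : f y = -2 * Real.cos (Real.pi / m)) (hgx : g x = -2 * Real.cos (Real.pi / m)) :
    (reflection hf * reflection hg) ^ m = 1 := by
  have ht : 2 * Real.cos (2 * (Real.pi / m)) = f y * g x - 2 := by
    rw [hfy, hgx, Real.cos_two_mul]; ring
  ext z
  rw [reflection_mul_reflection_pow_apply hf hg m z _ ht]
  obtain rfl | hm : m = 2 ∨ 3 ≤ m := by omega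
  · norm_num at hfy hgx ⊢
    simp [hfy, hgx, mul_div_cancel₀]
    module
  · have hm3 : (3 : ℝ) ≤ m := by exact_mod_cast hm
    have hm0 : (m : ℝ) ≠ 0 := by linarith
    have hpos := Real.pi_pos
    set θ := 2 * (Real.pi / (m : ℝ)) with hθ
    have hmθ : m * θ = 2 * Real.pi := by rw [hθ]; field_simp
    have hsin : Real.sin θ ≠ 0 := by
      refine (Real.sin_pos_of_pos_of_lt_pi (by positivity) ?_).ne'
      nlinarith
    have key (a b : ℤ) (hab : a + b + 2 = m) :
        (S ℝ a).eval (2 * Real.cos θ) + (S ℝ b).eval (2 * Real.cos θ) = 0 := by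
      refine (mul_eq_zero.mp ?_).resolve_right hsin
      have hb : ((b : ℝ) + 1) * θ = 2 * Real.pi - (a + 1) * θ := by
        have : (a : ℝ) + b + 2 = m := by exact_mod_cast hab
        linear_combination θ * this + hmθ
      rw [add_mul, S_two_mul_real_cos, S_two_mul_real_cos, hb, Real.sin_two_pi_sub]
      ring
    obtain ⟨k, rfl | rfl⟩ := Nat.even_or_odd' m
    · have h := key (k - 1) (k - 1) (by push_cast; ring)
      rw [← two_mul, mul_eq_zero, or_iff_right two_ne_zero] at h
      rw [show (((2 * k : ℕ) : ℤ) - 2) / 2 = k - 1 by omega,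
        show (((2 * k : ℕ) : ℤ) - 1) / 2 = k - 1 by omega, h]
      simp
    · have h := key k (k - 1) (by push_cast; ring)
      rw [show (((2 * k + 1 : ℕ) : ℤ) - 2) / 2 = k - 1 by omega,
        show (((2 * k + 1 : ℕ) : ℤ) - 1) / 2 = k by omega,
        show (((2 * k + 1 : ℕ) : ℤ) - 3) / 2 = k - 1 by omega,
        show (((2 * k + 1 : ℕ) : ℤ)) / 2 = k by omega, h]
      simp

variable [Fintype B]

open Classical in
/-- The simple root `α_i`. -/
noncomputable def simpleRoot (i : B) : B → ℝ := Pi.single i 1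

/-- The simple coroot `v ↦ 2 B(α_i, v)`. -/
noncomputable def simpleCoroot (i : B) : Dual ℝ (B → ℝ) :=
  ∑ j, (2 * formEntry M i j) • LinearMap.proj j

theorem simpleCoroot_simpleRoot (i j : B) :
    simpleCoroot M i (simpleRoot j) = 2 * formEntry M i j := by
  classical
  simp [simpleCoroot, simpleRoot, Pi.single_apply]

theorem simpleCoroot_simpleRoot_self (i : B) : simpleCoroot M i (simpleRoot i) = 2 := by
  rw [simpleCoroot_simpleRoot, formEntry_self, mul_one]

/-- The reflection in the simple root `α_i`. -/
noncomputable def simpleReflection (i : B) : (B → ℝ) ≃ₗ[ℝ] (B → ℝ) :=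
  reflection (simpleCoroot_simpleRoot_self M i)

theorem isLiftable_simpleReflection : M.IsLiftable (simpleReflection M) := by
  intro i j
  obtain h0 | h1 | h2 : M i j = 0 ∨ M i j = 1 ∨ 2 ≤ M i j := by omega
  · rw [h0, pow_zero]
  · obtain rfl : i = j := by
      by_contra hij
      exact M.off_diagonal i j hij h1
    rw [h1, pow_one]
    ext1 v
    exact involutive_reflection _ v
  · have hij : 2 * formEntry M i j = -2 * Real.cos (Real.pi / M i j) := by
      rw [formEntry, if_neg (by omega)]; ring
    exact reflection_mul_reflection_pow_eq_one _ _ h2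
      (by rw [simpleCoroot_simpleRoot, hij])
      (by rw [simpleCoroot_simpleRoot, formEntry_comm, hij])

/-- Distinct simple reflections joined by an edge of the Coxeter graph do not commute. -/
theorem simple_mul_simple_mul_simple_ne {W : Type*} [Group W] {M : CoxeterMatrix B}
    (cs : CoxeterSystem M W) {i j : B} (hij : i ≠ j) (h : M i j ≠ 2) :
    cs.simple j * cs.simple i * cs.simple j ≠ cs.simple i := by
  classical
  intro hc
  have hc' : cs.simple j * cs.simple i = cs.simple i * cs.simple j := by
    rw [← hc, mul_assoc _ (cs.simple j) (cs.simple j), cs.simple_mul_simple_self, mul_one, hc]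
  have := congrArg (cs.lift ⟨_, isLiftable_simpleReflection M⟩) hc'
  rw [map_mul, map_mul, cs.lift_apply_simple, cs.lift_apply_simple] at this
  have := congrFun (LinearEquiv.congr_fun this (simpleRoot j)) i
  simp only [LinearEquiv.mul_apply, simpleReflection, reflection_apply, map_sub, map_smul,
    simpleCoroot_simpleRoot, formEntry_self, formEntry_comm M j i] at this
  simp [simpleRoot, hij] at this
  exact formEntry_ne_zero M hij h (by linarith)

end Reflections

section InversionParity

variable {B W : Type*} [Group W] {M : CoxeterMatrix B} (cs : CoxeterSystem M W)

theorem end_one_apply {α : Type*} (a : α) : (1 : Function.End α) a = a := rfl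

theorem end_mul_apply {α : Type*} (f g : Function.End α) (a : α) : (f * g) a = f (g a) := rfl

open Classical in
/-- The action of a simple reflection on `W × ZMod 2`: conjugation on the first factor, flipping
the sign exactly above the simple reflection itself. -/
noncomputable def signedConj (i : B) : Function.End (W × ZMod 2) := fun p =>
  (cs.simple i * p.1 * cs.simple i, p.2 + if p.1 = cs.simple i then 1 else 0)

open Classical in
theorem signedConj_mul_pow_apply (i j : B) (n : ℕ) (p : W × ZMod 2) :
    ((signedConj cs i * signedConj cs j) ^ n : Function.End (W × ZMod 2)) p =
      ((cs.simple i * cs.simple j) ^ n * p.1 * ((cs.simple i * cs.simple j) ^ n)⁻¹,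
        p.2 + ∑ k ∈ Finset.range (2 * n),
          if p.1 = cs.simple j * (cs.simple i * cs.simple j) ^ k then 1 else 0) := by
  set c := cs.simple i * cs.simple j with hc
  have hconj (n : ℕ) : (c ^ n)⁻¹ * cs.simple j = cs.simple j * c ^ n := by
    induction n with
    | zero => simp
    | succ n ih =>
      rw [pow_succ, mul_inv_rev, mul_assoc, ih, ← mul_assoc, ← pow_succ, pow_succ', ← mul_assoc]
      simp [hc, mul_assoc]
  have hj (n : ℕ) : (c ^ n * p.1 * (c ^ n)⁻¹ = cs.simple j) ↔
      p.1 = cs.simple j * c ^ (2 * n) := by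
    rw [mul_inv_eq_iff_eq_mul, ← eq_inv_mul_iff_mul_eq, ← mul_assoc, hconj, mul_assoc, ← pow_add,
      two_mul]
  have hi (n : ℕ) : (cs.simple j * (c ^ n * p.1 * (c ^ n)⁻¹) * cs.simple j = cs.simple i) ↔
      p.1 = cs.simple j * c ^ (2 * n + 1) := by
    have : cs.simple j * (c ^ n * p.1 * (c ^ n)⁻¹) * cs.simple j = cs.simple i ↔
        c ^ n * p.1 * (c ^ n)⁻¹ = cs.simple j * c := by
      rw [mul_assoc, ← eq_inv_mul_iff_mul_eq, cs.inv_simple, ← eq_mul_inv_iff_mul_eq, cs.inv_simple,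
        hc, ← mul_assoc (cs.simple j)]
    rw [this, mul_inv_eq_iff_eq_mul, ← eq_inv_mul_iff_mul_eq, mul_assoc, ← mul_assoc, hconj,
      mul_assoc, ← pow_succ', ← pow_add]
    ring_nf
  induction n with
  | zero => simp [end_one_apply]
  | succ n ih =>
    rw [pow_succ', end_mul_apply, ih, mul_add, mul_one,
      Finset.sum_range_succ, Finset.sum_range_succ]
    simp only [end_mul_apply, signedConj, hj, hi]
    refine Prod.ext ?_ ?_
    · rw [pow_succ' c n, mul_inv_rev]
      simp [hc, mul_assoc]
    · simp only [add_assoc]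

theorem isLiftable_signedConj : M.IsLiftable (signedConj cs) := by
  classical
  intro i j
  funext p
  rw [signedConj_mul_pow_apply, cs.simple_mul_simple_pow, two_mul, Finset.sum_range_add]
  simp [pow_add, cs.simple_mul_simple_pow, CharTwo.add_self_eq_zero, end_one_apply]

/-- The parity of the number of occurrences of `t` in the right inversion sequence of any word
for `w`. -/
noncomputable def inversionParity (w t : W) : ZMod 2 :=
  (cs.lift ⟨signedConj cs, isLiftable_signedConj cs⟩ w (t, 0)).2

open Classical in
theorem lift_signedConj_wordProd (ω : List B) (p : W × ZMod 2) :
    cs.lift ⟨signedConj cs, isLiftable_signedConj cs⟩ (cs.wordProd ω) p =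
      (cs.wordProd ω * p.1 * (cs.wordProd ω)⁻¹, p.2 + ((cs.rightInvSeq ω).count p.1 : ZMod 2)) := by
  induction ω with
  | nil => simp [end_one_apply]
  | cons i ω ih =>
    rw [cs.wordProd_cons, map_mul, end_mul_apply, ih,
      cs.lift_apply_simple, CoxeterSystem.rightInvSeq, List.count_cons]
    simp only [signedConj]
    refine Prod.ext ?_ ?_
    · simp [mul_assoc]
    · have : (cs.wordProd ω * p.1 * (cs.wordProd ω)⁻¹ = cs.simple i) ↔
          (cs.wordProd ω)⁻¹ * cs.simple i * cs.wordProd ω = p.1 := by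
        rw [mul_inv_eq_iff_eq_mul, ← eq_inv_mul_iff_mul_eq, mul_assoc, eq_comm]
      simp [this, add_assoc]

open Classical in
theorem inversionParity_wordProd (ω : List B) (t : W) :
    inversionParity cs (cs.wordProd ω) t = ((cs.rightInvSeq ω).count t : ZMod 2) := by
  rw [inversionParity, lift_signedConj_wordProd, zero_add]

theorem inversionParity_mul (g h t : W) :
    inversionParity cs (g * h) t =
      inversionParity cs h t + inversionParity cs g (h * t * h⁻¹) := by
  classical
  obtain ⟨ω, rfl⟩ := cs.wordProd_surjective g
  obtain ⟨ω', rfl⟩ := cs.wordProd_surjective h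
  simp [inversionParity, end_mul_apply, lift_signedConj_wordProd]

open Classical in
theorem inversionParity_simple (i : B) (t : W) :
    inversionParity cs (cs.simple i) t = if t = cs.simple i then 1 else 0 := by
  rw [← cs.wordProd_singleton, inversionParity_wordProd]
  simp [List.count_singleton, eq_comm (a := cs.simple i)]

theorem inversionParity_simple_self (i : B) :
    inversionParity cs (cs.simple i) (cs.simple i) = 1 := by
  rw [inversionParity_simple, if_pos rfl]

theorem mem_rightInvSeq_of_inversionParity_ne_zero {ω : List B} {t : W}
    (h : inversionParity cs (cs.wordProd ω) t ≠ 0) : t ∈ cs.rightInvSeq ω := by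
  classical
  by_contra ht
  exact h (by rw [inversionParity_wordProd, List.count_eq_zero_of_not_mem ht, Nat.cast_zero])

/-- The strong exchange property. -/
theorem exists_eraseIdx_of_inversionParity_ne_zero {ω : List B} {t : W}
    (h : inversionParity cs (cs.wordProd ω) t ≠ 0) :
    ∃ k < ω.length, cs.wordProd ω * t = cs.wordProd (ω.eraseIdx k) := by
  obtain ⟨k, hk, rfl⟩ := List.mem_iff_getElem.mp
    (mem_rightInvSeq_of_inversionParity_ne_zero cs h)
  refine ⟨k, by simpa using hk, ?_⟩
  rw [← cs.wordProd_mul_getD_rightInvSeq, List.getD_eq_getElem _ _ hk]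

theorem length_mul_lt_of_inversionParity_ne_zero {w t : W} (h : inversionParity cs w t ≠ 0) :
    cs.length (w * t) < cs.length w := by
  obtain ⟨ω, hω, rfl⟩ := cs.exists_isReduced w
  obtain ⟨k, hk, heq⟩ := exists_eraseIdx_of_inversionParity_ne_zero cs h
  rw [heq, hω.eq]
  refine (cs.length_wordProd_le _).trans_lt ?_
  rw [List.length_eraseIdx_of_lt hk]
  omega

theorem exists_inversionParity_simple_eq_one {w : W} (hw : w ≠ 1) :
    ∃ i, inversionParity cs w (cs.simple i) = 1 := by
  obtain ⟨i, hi⟩ := cs.exists_rightDescent_of_ne_one hw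
  refine ⟨i, ?_⟩
  have h0 : inversionParity cs (w * cs.simple i) (cs.simple i) = 0 := by
    by_contra h
    have := length_mul_lt_of_inversionParity_ne_zero cs h
    rw [cs.simple_mul_simple_cancel_right] at this
    exact lt_asymm hi this
  have h1 := inversionParity_mul cs (w * cs.simple i) (cs.simple i) (cs.simple i)
  rwa [cs.simple_mul_simple_cancel_right, mul_inv_cancel_right, h0, inversionParity_simple_self,
    add_zero] at h1

theorem finite_setOf_inversionParity_ne_zero (w : W) :
    {t | inversionParity cs w t ≠ 0}.Finite := by
  obtain ⟨ω, rfl⟩ := cs.wordProd_surjective w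
  exact (cs.rightInvSeq ω).finite_toSet.subset fun t ht =>
    mem_rightInvSeq_of_inversionParity_ne_zero cs ht

/-- A Coxeter group of finite rank with finitely many reflections is finite. -/
theorem finite_of_finite_reflections [Finite B] (h : {t | cs.IsReflection t}.Finite) :
    Finite W := by
  classical
  have hlen (w : W) : cs.length w ≤ h.toFinset.card := by
    obtain ⟨ω, hω, rfl⟩ := cs.exists_isReduced w
    rw [hω.eq, ← cs.length_rightInvSeq, ← List.toFinset_card_of_nodup hω.nodup_rightInvSeq]
    refine Finset.card_le_card fun t ht => ?_
    simpa using cs.isReflection_of_mem_rightInvSeq ω (List.mem_toFinset.mp ht)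
  refine Set.finite_univ_iff.mp
    (((List.finite_length_le B h.toFinset.card).image cs.wordProd).subset fun w _ => ?_)
  obtain ⟨ω, hω, rfl⟩ := cs.exists_isReduced w
  exact ⟨ω, hω.eq.symm.trans_le (hlen _), rfl⟩

/-- An element without right descents in `J` has no right inversions in the parabolic subgroup
generated by `J`. -/
theorem inversionParity_eq_zero_of_parabolic {J : Set B} {x : W}
    (hx : ∀ i ∈ J, inversionParity cs x (cs.simple i) = 0) {ρ : List B} (hρ : ∀ i ∈ ρ, i ∈ J) :
    inversionParity cs x (cs.wordProd ρ) = 0 := by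
  let C : Set W := {v | ∃ ω : List B, (∀ i ∈ ω, i ∈ J) ∧ x = v * cs.wordProd ω}
  obtain ⟨v, hvC, hvmin⟩ :=
    exists_minimalFor_of_wellFoundedLT (· ∈ C) cs.length ⟨x, [], by simp, by simp⟩
  have hv {σ : List B} (hσ : ∀ i ∈ σ, i ∈ J) : inversionParity cs v (cs.wordProd σ) = 0 := by
    by_contra h
    have hlt := length_mul_lt_of_inversionParity_ne_zero cs h
    obtain ⟨ω, hω, rfl⟩ := hvC
    refine hlt.not_ge (hvmin ⟨σ.reverse ++ ω, ?_, ?_⟩ hlt.le)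
    · simpa [or_imp, forall_and] using ⟨hσ, hω⟩
    · rw [cs.wordProd_append, cs.wordProd_reverse]; group
  obtain ⟨ω, ⟨hω, hxω⟩, hmin⟩ := exists_minimalFor_of_wellFoundedLT
    (fun ω : List B => (∀ i ∈ ω, i ∈ J) ∧ x = v * cs.wordProd ω) List.length hvC
  obtain rfl | ⟨ω, i, rfl⟩ := ω.eq_nil_or_concat'
  · rw [hxω, cs.wordProd_nil, mul_one]
    exact hv hρ
  · exfalso
    have hωJ : ∀ k ∈ ω, k ∈ J := fun k hk => hω k (by simp [hk])
    have hiJ : i ∈ J := hω i (by simp)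
    have hi := hx i hiJ
    have hconj : inversionParity cs v
        (cs.wordProd ω * cs.simple i * (cs.wordProd ω)⁻¹) = 0 := by
      have := hv (σ := ω ++ [i] ++ ω.reverse) (by grind)
      rwa [cs.wordProd_append, cs.wordProd_append, cs.wordProd_singleton,
        cs.wordProd_reverse] at this
    rw [hxω, cs.wordProd_append, cs.wordProd_singleton, ← mul_assoc, inversionParity_mul,
      inversionParity_mul, mul_inv_cancel_right, hconj, inversionParity_simple_self] at hi
    have hne : inversionParity cs (cs.wordProd ω) (cs.simple i) ≠ 0 := fun h => by
      simp [h] at hi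
    obtain ⟨k, hk, heq⟩ := exists_eraseIdx_of_inversionParity_ne_zero cs hne
    have hlen := List.length_eraseIdx_of_lt hk
    have := hmin (j := ω.eraseIdx k)
      ⟨fun l hl => hωJ l (List.mem_of_mem_eraseIdx hl), by
        rw [hxω, ← heq, cs.wordProd_append, cs.wordProd_singleton]⟩
      (by rw [hlen]; simp; omega)
    rw [hlen] at this
    simp at this
    omega

theorem inversionParity_conj_of_mem_center {w : W} (hw : w ∈ Subgroup.center W) (g t : W) :
    inversionParity cs w (g * t * g⁻¹) = inversionParity cs w t := by
  have h := inversionParity_mul cs w g t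
  rw [← Subgroup.mem_center_iff.mp hw g, inversionParity_mul,
    ← Subgroup.mem_center_iff.mp hw t, mul_inv_cancel_right, add_comm] at h
  exact (add_left_cancel h).symm

/-- The right descent set of a central element is a union of connected components of the
Coxeter graph. -/
theorem inversionParity_eq_one_of_adj [Fintype B] {w : W} (hw : w ∈ Subgroup.center W) {i j : B}
    (hadj : (coxeterGraph M).Adj i j) (hi : inversionParity cs w (cs.simple i) = 1) :
    inversionParity cs w (cs.simple j) = 1 := by
  by_contra hj1
  have hj : inversionParity cs w (cs.simple j) = 0 := by
    generalize inversionParity cs w (cs.simple j) = a at hj1 ⊢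
    revert a; decide
  obtain ⟨hij, hM⟩ := (SimpleGraph.fromRel_adj _ _ _).mp hadj
  have hM2 : M i j ≠ 2 := hM.elim id fun h => by rwa [M.symmetric]
  have hx (t : W) : inversionParity cs (w * cs.simple i) t =
      inversionParity cs (cs.simple i) t + inversionParity cs w t := by
    rw [inversionParity_mul, inversionParity_conj_of_mem_center cs hw]
  have hsne : cs.simple j ≠ cs.simple i := fun h => by simp [← h, hj] at hi
  have key := inversionParity_eq_zero_of_parabolic cs (J := {i, j}) (x := w * cs.simple i)
    (ρ := [j, i, j]) ?_ (by simp)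
  · have hconj := inversionParity_conj_of_mem_center cs hw (cs.simple j) (cs.simple i)
    rw [cs.inv_simple, hi] at hconj
    have hprod : cs.wordProd [j, i, j] = cs.simple j * cs.simple i * cs.simple j := by
      simp [CoxeterSystem.wordProd, mul_assoc]
    rw [hprod, hx, hconj, inversionParity_simple,
      if_neg (simple_mul_simple_mul_simple_ne cs hij hM2)] at key
    simp at key
  · rintro k (rfl | rfl)
    · rw [hx, hi, inversionParity_simple_self, CharTwo.add_self_eq_zero]
    · rw [hx, hj, inversionParity_simple, if_neg hsne, add_zero]

end InversionParity

/-- The center of an irreducible, infinite Coxeter group is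
trivial. -/
theorem center_eq_bot_of_irreducible_infinite
    {B W : Type*} [Fintype B] [Group W] {M : CoxeterMatrix B} (cs : CoxeterSystem M W)
    (hirr : IsIrreducible M) (hinf : Infinite W) :
    Subgroup.center W = ⊥ := by
  refine (Subgroup.eq_bot_iff_forall _).mpr fun w hw => ?_
  by_contra hne
  obtain ⟨i, hi⟩ := exists_inversionParity_simple_eq_one cs hne
  have hall (j : B) : inversionParity cs w (cs.simple j) = 1 := by
    have hij := (SimpleGraph.reachable_iff_reflTransGen i j).mp (hirr.preconnected i j)
    induction hij with
    | refl => exact hi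
    | tail _ hadj ih => exact inversionParity_eq_one_of_adj cs hw hadj ih
  refine not_finite_iff_infinite.mpr hinf (finite_of_finite_reflections cs
    ((finite_setOf_inversionParity_ne_zero cs w).subset ?_))
  rintro _ ⟨g, j, rfl⟩
  simp [inversionParity_conj_of_mem_center cs hw, hall]

end CoxeterPaper
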